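/- arXiv:1807.07811 — 3 statements merged into one kernel-verified Lean document; each statement's English description precedes it below -/
import Mathlib

section
/- Let N ≥ 2, let P be a probability measure on ℝ^N with Lebesgue density z ↦ 2^{−N/2} g(‖z‖²) for a density generator g, let Z be the identity random vector on (ℝ^N, P), and let ψ : (0,∞) → ℝ be measurable with E{‖ψ(‖Z‖²) Z‖} < ∞. Then the conditional expectation of the random vector ψ(‖Z‖²) Z given the σ-algebra generated by ‖Z‖ is 0 almost surely: E{ψ(‖Z‖²) Z | ‖Z‖} = 0 a.s. -/
open MeasureTheory Set

/-- An odd integrable function has zero conditional expectation with respect to any σ-algebra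
generated by an even function, if the law is invariant under negation. -/
theorem condExp_comap_ae_eq_zero_of_odd {E F β : Type*} [AddGroup E] [MeasurableSpace E]
    [MeasurableNeg E] [NormedAddCommGroup F] [NormedSpace ℝ F] [CompleteSpace F]
    [mβ : MeasurableSpace β] {μ : Measure E} [IsFiniteMeasure μ] [μ.IsNegInvariant]
    {r : E → β} (hr : Measurable r) (hr_even : ∀ x, r (-x) = r x)
    {f : E → F} (hf : Integrable f μ) (hf_odd : ∀ x, f (-x) = -f x) :
    μ[f | mβ.comap r] =ᵐ[μ] 0 := by
  refine (ae_eq_condExp_of_forall_setIntegral_eq hr.comap_le hf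
    (fun _ _ _ => integrableOn_zero) ?_ aestronglyMeasurable_zero).symm
  rintro _ ⟨t, -, rfl⟩ -
  have key := (Measure.measurePreserving_neg μ).setIntegral_preimage_emb
    (MeasurableEquiv.neg E).measurableEmbedding f (r ⁻¹' t)
  have hpre : Neg.neg ⁻¹' (r ⁻¹' t) = r ⁻¹' t := by ext x; simp [hr_even]
  simp only [hf_odd, hpre, integral_neg] at key
  have : IsAddTorsionFree F := .of_isTorsionFree ℝ F
  simpa using (self_eq_neg.1 key.symm).symm

/-- A measure with an even density with respect to a negation-invariant measure is
negation-invariant. -/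
theorem isNegInvariant_withDensity_of_even {E : Type*} [AddGroup E] [MeasurableSpace E]
    [MeasurableNeg E] {μ : Measure E} [μ.IsNegInvariant] {d : E → ENNReal}
    (hd_even : ∀ x, d (-x) = d x) : (μ.withDensity d).IsNegInvariant := by
  refine ⟨Measure.ext fun s hs => ?_⟩
  have key := (Measure.measurePreserving_neg μ).setLIntegral_comp_preimage_emb
    (MeasurableEquiv.neg E).measurableEmbedding d s
  rw [Measure.neg, Measure.map_apply measurable_neg hs, withDensity_apply _ hs,
    withDensity_apply _ (measurable_neg hs), ← key]
  simp only [hd_even]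

/-- For a spherically symmetric law `P` with density `z ↦ 2^{-N/2} g(‖z‖²)`
on `ℝ^N` (N ≥ 2) and any measurable `ψ` with `E‖ψ(‖Z‖²) Z‖ < ∞`, the conditional
expectation of `ψ(‖Z‖²) Z` given the σ-algebra generated by `‖Z‖` vanishes a.s. -/
theorem stmt_13 (N : ℕ) (hN : 2 ≤ N) (g : ℝ → ℝ) (hg : Measurable g)
    (hg0 : ∀ t ∈ Ioi (0 : ℝ), 0 ≤ g t)
    (hgint : IntegrableOn (fun t => t ^ ((N : ℝ) / 2 - 1) * g t) (Ioi (0 : ℝ)))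
    (P : Measure (EuclideanSpace ℝ (Fin N)))
    (hP : P = volume.withDensity
      (fun z => ENNReal.ofReal ((2 : ℝ) ^ (-(N : ℝ) / 2) * g (‖z‖ ^ 2))))
    (hPprob : IsProbabilityMeasure P)
    (ψ : ℝ → ℝ) (hψ : Measurable ψ)
    (hint : Integrable (fun z : EuclideanSpace ℝ (Fin N) => ψ (‖z‖ ^ 2) • z) P) :
    P[(fun z : EuclideanSpace ℝ (Fin N) => ψ (‖z‖ ^ 2) • z) |
        MeasurableSpace.comap (fun z : EuclideanSpace ℝ (Fin N) => ‖z‖) inferInstance]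
      =ᵐ[P] 0 := by
  subst hP
  have := isNegInvariant_withDensity_of_even (μ := volume)
    (d := fun z : EuclideanSpace ℝ (Fin N) =>
      ENNReal.ofReal ((2 : ℝ) ^ (-(N : ℝ) / 2) * g (‖z‖ ^ 2))) (by simp)
  exact condExp_comap_ae_eq_zero_of_odd measurable_norm norm_neg hint (by simp)
end

section
/- Let N ≥ 1 be an integer and let λ, η > 0. Let p_Q(q) = (Γ((λ+N)/2)/(Γ(λ/2)Γ(N/2))) (λ/η)^{λ/2} q^{N/2−1} (λ/η+q)^{−(λ+N)/2} and ψ₀(t) = −(λ+N) / (2(λ/η + t)). Then ∫₀^∞ q · ψ₀(q)² · p_Q(q) dq = η N (λ + N) / (4 (N + λ + 2)). -/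
open MeasureTheory Set Real

lemma image_div_add_Ioi {c : ℝ} (hc : 0 < c) :
    (fun q : ℝ => q / (c + q)) '' Ioi 0 = Ioo 0 1 := by
  ext x
  simp only [mem_image, mem_Ioi, mem_Ioo]
  constructor
  · rintro ⟨q, hq, rfl⟩
    exact ⟨by positivity, (div_lt_one (by positivity)).2 (by linarith)⟩
  · rintro ⟨hx0, hx1⟩
    have h : 0 < 1 - x := by linarith
    refine ⟨c * x / (1 - x), by positivity, ?_⟩
    field_simp
    ring

lemma injOn_div_add_Ioi {c : ℝ} (hc : 0 < c) :
    InjOn (fun q : ℝ => q / (c + q)) (Ioi 0) := by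
  intro x hx y hy h
  rw [mem_Ioi] at hx hy
  have hcx : c + x ≠ 0 := by positivity
  have hcy : c + y ≠ 0 := by positivity
  simp only [div_eq_div_iff hcx hcy] at h
  exact mul_left_cancel₀ hc.ne' (by linarith)

/-- The beta integral over the half-line, with a scale parameter. -/
lemma integral_rpow_mul_add_rpow_Ioi {a b c : ℝ} (ha : 0 < a) (hb : 0 < b) (hc : 0 < c) :
    ∫ q in Ioi (0 : ℝ), q ^ (a - 1) * (c + q) ^ (-(a + b)) =
      c ^ (-b) * ProbabilityTheory.beta a b := by
  have hderiv : ∀ q ∈ Ioi (0 : ℝ),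
      HasDerivWithinAt (fun q : ℝ => q / (c + q)) (c / (c + q) ^ 2) (Ioi 0) q := by
    intro q hq
    rw [mem_Ioi] at hq
    have h := (hasDerivAt_id q).div ((hasDerivAt_id q).const_add c)
      (by simp only [id]; positivity)
    refine (h.congr_deriv ?_).hasDerivWithinAt
    simp
  have hcov := integral_image_eq_integral_abs_deriv_smul measurableSet_Ioi hderiv
    (injOn_div_add_Ioi hc) (fun x : ℝ => x ^ (a - 1) * (1 - x) ^ (b - 1))
  have hbeta : ∫ x in Ioo (0 : ℝ) 1, x ^ (a - 1) * (1 - x) ^ (b - 1) =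
      ProbabilityTheory.beta a b := by
    rw [ProbabilityTheory.beta_eq_betaIntegralReal a b ha hb, Complex.betaIntegral,
      intervalIntegral.integral_of_le zero_le_one, ← integral_Ioc_eq_integral_Ioo,
      ← RCLike.re_eq_complex_re, ← integral_re]
    · refine setIntegral_congr_fun measurableSet_Ioc fun x hx => ?_
      norm_cast
      rw [← Complex.ofReal_cpow hx.1.le, ← Complex.ofReal_cpow (by linarith [hx.2]),
        RCLike.re_eq_complex_re, Complex.re_mul_ofReal, Complex.ofReal_re]
    · exact (intervalIntegrable_iff_integrableOn_Ioc_of_le zero_le_one).1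
        (Complex.betaIntegral_convergent (by simpa) (by simpa))
  rw [image_div_add_Ioi hc, hbeta] at hcov
  rw [hcov, ← integral_const_mul]
  refine setIntegral_congr_fun measurableSet_Ioi fun q hq => ?_
  rw [mem_Ioi] at hq
  have hcq : 0 < c + q := by positivity
  have hsub : 1 - q / (c + q) = c / (c + q) := by field_simp; ring
  simp only [smul_eq_mul]
  rw [hsub, abs_of_pos (by positivity), div_rpow hq.le hcq.le, div_rpow hc.le hcq.le,
    rpow_neg hcq.le, rpow_neg hc.le, rpow_add hcq, rpow_sub_one hc.ne',
    rpow_sub_one hcq.ne', rpow_sub_one hcq.ne']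
  have := rpow_pos_of_pos hc b
  have := rpow_pos_of_pos hcq a
  have := rpow_pos_of_pos hcq b
  field_simp

/-- for the t-distribution with shape `λ = lam` and scale `η`,
`E{Q ψ₀(Q)²} = ∫₀^∞ q ψ₀(q)² p_Q(q) dq = η N (λ+N) / (4(N+λ+2))`. -/
theorem stmt_17 (N : ℕ) (hN : 1 ≤ N) (lam η : ℝ) (hlam : 0 < lam) (hη : 0 < η)
    (pQ : ℝ → ℝ)
    (hpQ : pQ = fun q =>
      Real.Gamma ((lam + N) / 2) / (Real.Gamma (lam / 2) * Real.Gamma ((N : ℝ) / 2)) *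
        (lam / η) ^ (lam / 2) * q ^ ((N : ℝ) / 2 - 1) * (lam / η + q) ^ (-(lam + N) / 2))
    (ψ₀ : ℝ → ℝ) (hψ₀ : ψ₀ = fun t => -(lam + N) / (2 * (lam / η + t))) :
    (∫ q in Ioi (0 : ℝ), q * ψ₀ q ^ 2 * pQ q) =
      η * N * (lam + N) / (4 * (N + lam + 2)) := by
  have hN' : (0 : ℝ) < N := by exact_mod_cast hN
  generalize (N : ℝ) = n at *
  obtain ⟨c, hc⟩ : ∃ c, c = lam / η := ⟨_, rfl⟩
  have hc0 : 0 < c := hc ▸ by positivity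
  subst hpQ hψ₀
  rw [← hc]
  have hcongr : ∀ q ∈ Ioi (0 : ℝ),
      q * (-(lam + n) / (2 * (c + q))) ^ 2 *
        (Gamma ((lam + n) / 2) / (Gamma (lam / 2) * Gamma (n / 2)) *
          c ^ (lam / 2) * q ^ (n / 2 - 1) * (c + q) ^ (-(lam + n) / 2)) =
      (lam + n) ^ 2 / 4 * (Gamma ((lam + n) / 2) / (Gamma (lam / 2) * Gamma (n / 2)) *
          c ^ (lam / 2)) *
        (q ^ (n / 2 + 1 - 1) * (c + q) ^ (-((n / 2 + 1) + (lam / 2 + 1)))) := by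
    intro q hq
    rw [mem_Ioi] at hq
    have hcq : 0 < c + q := by positivity
    have hexp : -((n / 2 + 1) + (lam / 2 + 1)) = -(lam + n) / 2 - (2 : ℕ) := by
      push_cast; ring
    rw [hexp, rpow_sub_natCast hcq.ne', rpow_sub_one hq.ne', add_sub_cancel_right]
    field_simp
    ring
  rw [setIntegral_congr_fun measurableSet_Ioi hcongr, integral_const_mul,
    integral_rpow_mul_add_rpow_Ioi (by positivity) (by positivity) hc0,
    ProbabilityTheory.beta]
  have hsum : n / 2 + 1 + (lam / 2 + 1) = (lam + n) / 2 + 1 + 1 := by ring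
  rw [hsum, Gamma_add_one (by positivity), Gamma_add_one (by positivity),
    Gamma_add_one (by positivity), Gamma_add_one (by positivity),
    rpow_neg hc0.le, rpow_add_one hc0.ne']
  have h1 := Gamma_pos_of_pos (show 0 < lam / 2 by positivity)
  have h2 := Gamma_pos_of_pos (show 0 < n / 2 by positivity)
  have h3 := Gamma_pos_of_pos (show 0 < (lam + n) / 2 by positivity)
  have h4 := rpow_pos_of_pos hc0 (lam / 2)
  generalize c ^ (lam / 2) = C at *
  subst hc
  field_simp
  ring
end

section
/- Let N ≥ 1 be an integer and let s, b > 0. Let p_Q(q) = (s · q^{N/2−1} / ((2b)^{N/(2s)} Γ(N/(2s)))) · exp(−q^s/(2b)) for q > 0, and ψ₀(t) = −s t^{s−1}/(2b). Then ∫₀^∞ p_Q(q) dq = 1 and ∫₀^∞ q² · ψ₀(q)² · p_Q(q) dq = N (N + 2s) / 4. -/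
open MeasureTheory Set Real

theorem integral_rpow_mul_exp_neg_rpow_div {s a c : ℝ} (hs : 0 < s) (ha : 0 < a) (hc : 0 < c) :
    ∫ x in Ioi (0 : ℝ), x ^ (s * a - 1) * Real.exp (-(x ^ s / c)) =
      c ^ a * Real.Gamma a / s := by
  have h := integral_rpow_mul_exp_neg_mul_rpow (p := s) (q := s * a - 1) (b := c⁻¹) hs
    (by linarith [mul_pos hs ha]) (inv_pos.mpr hc)
  have hdiv : (s * a - 1 + 1) / s = a := by field_simp; ring
  rw [neg_div, hdiv, inv_rpow hc.le, rpow_neg hc.le, inv_inv] at h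
  calc
    _ = ∫ x in Ioi (0 : ℝ), x ^ (s * a - 1) * Real.exp (-c⁻¹ * x ^ s) := by
      congr with x
      ring_nf
    _ = _ := by rw [h]; ring

/-- for the Generalized Gaussian distribution with shape `s` and scale `b`,
the density `p_Q(q) = s q^{N/2-1} exp(-q^s/(2b)) / ((2b)^{N/(2s)} Γ(N/(2s)))` of the
2nd-order modular variate integrates to 1, and with `ψ₀(t) = -s t^{s-1}/(2b)` one has
`E{Q² ψ₀(Q)²} = ∫₀^∞ q² ψ₀(q)² p_Q(q) dq = N(N+2s)/4`. -/
theorem stmt_19 (N : ℕ) (hN : 1 ≤ N) (s b : ℝ) (hs : 0 < s) (hb : 0 < b)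
    (pQ : ℝ → ℝ)
    (hpQ : pQ = fun q =>
      s * q ^ ((N : ℝ) / 2 - 1) / ((2 * b) ^ ((N : ℝ) / (2 * s)) *
        Real.Gamma ((N : ℝ) / (2 * s))) * Real.exp (-(q ^ s / (2 * b))))
    (ψ₀ : ℝ → ℝ) (hψ₀ : ψ₀ = fun t => -(s * t ^ (s - 1)) / (2 * b)) :
    (∫ q in Ioi (0 : ℝ), pQ q) = 1 ∧
    (∫ q in Ioi (0 : ℝ), q ^ 2 * ψ₀ q ^ 2 * pQ q) = N * (N + 2 * s) / 4 := by
  subst hpQ hψ₀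
  have hN₀ : (0 : ℝ) < N := by exact_mod_cast hN
  have hc : 0 < 2 * b := by positivity
  obtain ⟨a, ha_def⟩ : ∃ a : ℝ, a = (N : ℝ) / (2 * s) := ⟨_, rfl⟩
  have ha : 0 < a := by rw [ha_def]; positivity
  have hN_eq : (N : ℝ) = 2 * s * a := by rw [ha_def]; field_simp
  have hΓ : Real.Gamma a ≠ 0 := (Real.Gamma_pos_of_pos ha).ne'
  have hpow : (2 * b) ^ a ≠ 0 := (rpow_pos_of_pos hc a).ne'
  have hexp : (N : ℝ) / 2 - 1 = s * a - 1 := by rw [hN_eq]; ring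
  simp only [← ha_def, hexp]
  constructor
  · calc
      _ = ∫ q in Ioi (0 : ℝ), s / ((2 * b) ^ a * Real.Gamma a) *
            (q ^ (s * a - 1) * Real.exp (-(q ^ s / (2 * b)))) := by
        congr with q
        ring
      _ = 1 := by
        rw [integral_const_mul, integral_rpow_mul_exp_neg_rpow_div hs ha hc]
        field_simp
  · calc
      _ = ∫ q in Ioi (0 : ℝ), s ^ 3 / ((2 * b) ^ 2 * ((2 * b) ^ a * Real.Gamma a)) *
            (q ^ (s * (a + 2) - 1) * Real.exp (-(q ^ s / (2 * b)))) := by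
        refine setIntegral_congr_fun measurableSet_Ioi fun q hq => ?_
        have hq : 0 < q := hq
        have hq_pow : q ^ (s * (a + 2) - 1) = q ^ 2 * (q ^ (s - 1)) ^ 2 * q ^ (s * a - 1) := by
          rw [← rpow_natCast q 2, ← rpow_mul_natCast hq.le, ← rpow_add hq, ← rpow_add hq]
          congr 1
          push_cast
          ring
        simp only [hq_pow]
        field_simp
      _ = N * (N + 2 * s) / 4 := by
        have hΓ₂ : Real.Gamma (a + 2) = (a + 1) * (a * Real.Gamma a) := by
          rw [show a + 2 = a + 1 + 1 by ring, Real.Gamma_add_one (by positivity),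
            Real.Gamma_add_one ha.ne']
        have hpow₂ : (2 * b) ^ (a + 2) = (2 * b) ^ a * (2 * b) ^ 2 := by
          rw [rpow_add hc, rpow_ofNat]
        rw [integral_const_mul, integral_rpow_mul_exp_neg_rpow_div hs (by positivity) hc,
          hΓ₂, hpow₂, hN_eq]
        field_simp
        ring
end
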